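/- Let Γ ∈ F_{q^m}[X] have degree r ≥ 1, let x ∈ F_{q^m}^n have pairwise distinct entries with Γ(x_i) ≠ 0 for all i, let y_i = 1/Γ(x_i), let C = GRS_r(x,y), and set f = ⌊log_q(r)⌋. Then for every integer u with 0 ≤ u ≤ f, Tr(C ⋆ C^{q^u}) = B_u; moreover these codes form a chain: Tr(C ⋆ C) ⊆ Tr(C ⋆ C^{q}) ⊆ … ⊆ Tr(C ⋆ C^{q^f}). -/

import Mathlib

open Finset Polynomial

noncomputable section

/-- Componentwise (Schur) product of two linear codes of length `n` over `F`:
the `F`-linear span of `{c ⋆ d : c ∈ C, d ∈ D}`. -/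
def schurProd {F : Type*} [Field F] {n : ℕ} (C D : Submodule F (Fin n → F)) :
    Submodule F (Fin n → F) :=
  Submodule.span F {v | ∃ c ∈ C, ∃ d ∈ D, v = c * d}

/-- Dual code with respect to the standard bilinear form `⟨u,v⟩ = ∑ i, u i * v i`. -/
def dualCode {F : Type*} [Field F] {n : ℕ} (C : Submodule F (Fin n → F)) :
    Submodule F (Fin n → F) where
  carrier := {v | ∀ c ∈ C, ∑ i, v i * c i = 0}
  add_mem' := by
    intro a b ha hb c hc
    simp only [Set.mem_setOf_eq] at *
    simp [Pi.add_apply, add_mul, Finset.sum_add_distrib, ha c hc, hb c hc]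
  zero_mem' := by
    intro c hc
    simp
  smul_mem' := by
    intro t a ha c hc
    simp only [Set.mem_setOf_eq] at *
    simp [Pi.smul_apply, smul_eq_mul, mul_assoc, ← Finset.mul_sum, ha c hc]

/-- Image of a code under the componentwise `t`-th power map (as the span of the
image set, which is a linear code). For `t = q^i` this is `C^{q^i}`. -/
def powCode {F : Type*} [Field F] {n : ℕ} (t : ℕ) (C : Submodule F (Fin n → F)) :
    Submodule F (Fin n → F) :=
  Submodule.span F ((fun c : Fin n → F => fun j => c j ^ t) '' C)

/-- Generalized Reed–Solomon code of dimension `r`, support `x` and multiplier `y`. -/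
def GRSCode {F : Type*} [Field F] {n : ℕ} (r : ℕ) (x y : Fin n → F) :
    Submodule F (Fin n → F) :=
  Submodule.span F
    {v | ∃ P : F[X], P.degree < (r : WithBot ℕ) ∧ v = fun i => y i * P.eval (x i)}

variable (Fq Fqm : Type*) [Field Fq] [Field Fqm] [Algebra Fq Fqm]

/-- The componentwise trace map `F_{q^m}^n → F_q^n`, as an `F_q`-linear map. -/
def trVecLM (n : ℕ) : (Fin n → Fqm) →ₗ[Fq] (Fin n → Fq) :=
  LinearMap.pi fun i => (Algebra.trace Fq Fqm).comp (LinearMap.proj i)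

/-- The trace code `Tr(C)` of an `F_{q^m}`-linear code `C`. -/
def traceCode {n : ℕ} (C : Submodule Fqm (Fin n → Fqm)) : Submodule Fq (Fin n → Fq) :=
  Submodule.map (trVecLM Fq Fqm n) (C.restrictScalars Fq)

/-- The componentwise inclusion `F_q^n → F_{q^m}^n`, as an `F_q`-linear map. -/
def algVecLM (n : ℕ) : (Fin n → Fq) →ₗ[Fq] (Fin n → Fqm) :=
  LinearMap.pi fun i => (Algebra.linearMap Fq Fqm).comp (LinearMap.proj i)

/-- The alternant code `Alt_r(x,y) = GRS_r(x,y)^⊥ ∩ F_q^n`, a code over `F_q`. -/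
def AltCode {n : ℕ} (r : ℕ) (x y : Fin n → Fqm) : Submodule Fq (Fin n → Fq) :=
  Submodule.comap (algVecLM Fq Fqm n) ((dualCode (GRSCode r x y)).restrictScalars Fq)

/-- The codes `B_v`: `B_0 = Alt_{2r-1}(x, y^2)^⊥` and
`B_v = Alt_{r(q^v - q^{v-1} + 1)}(x, y^{q^v+1})^⊥` for `v ≥ 1`. -/
def BCode (q : ℕ) {n : ℕ} (r : ℕ) (x y : Fin n → Fqm) : ℕ → Submodule Fq (Fin n → Fq)
  | 0 => dualCode (AltCode Fq Fqm (2 * r - 1) x fun i => y i ^ 2)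
  | (v + 1) =>
      dualCode (AltCode Fq Fqm (r * (q ^ (v + 1) - q ^ v + 1)) x
        fun i => y i ^ (q ^ (v + 1) + 1))

end

theorem mem_GRSCode_iff {F : Type*} [Field F] {n r : ℕ} {x y v : Fin n → F} :
    v ∈ GRSCode r x y ↔
      ∃ P : F[X], P.degree < (r : WithBot ℕ) ∧ v = fun i => y i * P.eval (x i) := by
  refine ⟨fun hv => ?_, fun hv => Submodule.subset_span hv⟩
  induction hv using Submodule.span_induction with
  | mem w hw => exact hw
  | zero => exact ⟨0, by simp, by ext i; simp⟩
  | add v w _ _ hv hw =>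
    obtain ⟨P, hP, rfl⟩ := hv
    obtain ⟨Q, hQ, rfl⟩ := hw
    exact ⟨P + Q, (degree_add_le P Q).trans_lt (max_lt hP hQ), by ext i; simp [mul_add]⟩
  | smul a v _ hv =>
    obtain ⟨P, hP, rfl⟩ := hv
    refine ⟨C a * P, ?_, by ext i; simp [mul_left_comm]⟩
    rw [← smul_eq_C_mul]
    exact (degree_smul_le a P).trans_lt hP

theorem Polynomial.degree_lt_of_natDegree_lt {R : Type*} [Semiring R] {P : R[X]} {N : ℕ}
    (h : P.natDegree < N) : P.degree < (N : WithBot ℕ) :=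
  degree_le_natDegree.trans_lt (by exact_mod_cast h)

theorem Polynomial.natDegree_lt_of_degree_lt {R : Type*} [Semiring R] {P : R[X]} {N : ℕ}
    (hN : 0 < N) (h : P.degree < (N : WithBot ℕ)) : P.natDegree < N := by
  by_cases hP : P = 0
  · simpa [hP] using hN
  · exact (natDegree_lt_iff_degree_lt hP).2 h

theorem Polynomial.exists_eq_mul_add {F : Type*} [Field F] (P G : F[X]) (hG : G ≠ 0)
    (h : G.natDegree ≤ P.natDegree) :
    ∃ A R : F[X], P = G * A + R ∧ R.degree < (G.natDegree : WithBot ℕ) ∧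
      G.natDegree + A.natDegree = P.natDegree := by
  refine ⟨P / G, P % G, (EuclideanDomain.div_add_mod P G).symm, ?_, ?_⟩
  · rw [← degree_eq_natDegree hG]
    exact degree_mod_lt P hG
  · by_cases hP : P = 0
    · subst hP
      simp at h
      simp [h]
    have hd := degree_add_div hG (p := P) (by
      rw [degree_eq_natDegree hG, degree_eq_natDegree hP]
      exact_mod_cast h)
    have hA : P / G ≠ 0 := by
      intro h0
      rw [h0, degree_zero, WithBot.add_bot] at hd
      exact hP (degree_eq_bot.1 hd.symm)
    rw [degree_eq_natDegree hG, degree_eq_natDegree hA, degree_eq_natDegree hP] at hd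
    exact_mod_cast hd

theorem dualCode_dualCode {F : Type*} [Field F] {n : ℕ} (T : Submodule F (Fin n → F)) :
    dualCode (dualCode T) = T := by
  refine le_antisymm (fun v hv => ?_) fun v hv w hw => ?_
  · by_contra hvT
    obtain ⟨g, hgv, hg⟩ := Submodule.exists_le_ker_of_notMem hvT
    have hrep (u : Fin n → F) : g u = ∑ i, u i * g (Pi.single i 1) := by
      conv_lhs => rw [pi_eq_sum_univ' u]
      simp [map_sum, Pi.single]
    refine hgv ((hrep v).trans (hv (fun i => g (Pi.single i 1)) fun c hc => ?_))
    simp_rw [mul_comm _ (c _)]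
    rw [← hrep]
    exact hg hc
  · simp_rw [mul_comm (v _)]
    exact hw v hv

theorem dualCode_AltCode (Fq Fqm : Type*) [Field Fq] [Field Fqm] [Algebra Fq Fqm]
    [FiniteDimensional Fq Fqm] [Algebra.IsSeparable Fq Fqm] {n : ℕ} (r : ℕ)
    (x y : Fin n → Fqm) :
    dualCode (AltCode Fq Fqm r x y) = traceCode Fq Fqm (GRSCode r x y) := by
  rw [← dualCode_dualCode (traceCode Fq Fqm (GRSCode r x y))]
  congr 1
  have key (c : Fin n → Fq) (d : Fin n → Fqm) :
      ∑ i, c i * Algebra.trace Fq Fqm (d i) =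
        Algebra.trace Fq Fqm (∑ i, algebraMap Fq Fqm (c i) * d i) := by
    simp [map_sum, ← Algebra.smul_def]
  ext c
  constructor
  · rintro hc _ ⟨d, hd, rfl⟩
    exact (key c d).trans ((congrArg _ (hc d hd)).trans (map_zero _))
  · intro hc d hd
    refine (traceForm_nondegenerate Fq Fqm).1 _ fun a => ?_
    have := hc _ ⟨a • d, Submodule.smul_mem _ a hd, rfl⟩
    rw [Algebra.traceForm_apply, Finset.sum_mul]
    refine Eq.trans ?_ ((key c (a • d)).symm.trans this)
    congr 1
    refine Finset.sum_congr rfl fun i _ => ?_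
    simp only [algVecLM, LinearMap.pi_apply, LinearMap.comp_apply, LinearMap.proj_apply,
      Algebra.linearMap_apply, Pi.smul_apply, smul_eq_mul]
    ring

theorem schurProd_powCode_GRSCode {F : Type*} [Field F] {n r t : ℕ} (hr : 1 ≤ r) (ht : 1 ≤ t)
    (htr : t ≤ r) (x y : Fin n → F) :
    schurProd (GRSCode r x y) (powCode t (GRSCode r x y)) =
      GRSCode ((r - 1) * (t + 1) + 1) x fun i => y i ^ (t + 1) := by
  apply le_antisymm
  · have hpow : powCode t (GRSCode r x y) ≤ GRSCode ((r - 1) * t + 1) x fun i => y i ^ t := by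
      refine Submodule.span_le.2 ?_
      rintro _ ⟨c, hc, rfl⟩
      obtain ⟨P, hP, rfl⟩ := mem_GRSCode_iff.1 hc
      refine mem_GRSCode_iff.2 ⟨P ^ t, degree_lt_of_natDegree_lt ?_, by ext i; simp [mul_pow]⟩
      have := natDegree_lt_of_degree_lt hr hP
      calc (P ^ t).natDegree ≤ t * P.natDegree := natDegree_pow_le
        _ ≤ t * (r - 1) := Nat.mul_le_mul_left _ (by omega)
        _ < (r - 1) * t + 1 := by rw [mul_comm]; omega
    refine Submodule.span_le.2 ?_
    rintro _ ⟨c, hc, d, hd, rfl⟩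
    obtain ⟨P, hP, rfl⟩ := mem_GRSCode_iff.1 hc
    obtain ⟨Q, hQ, rfl⟩ := mem_GRSCode_iff.1 (hpow hd)
    refine mem_GRSCode_iff.2 ⟨P * Q, degree_lt_of_natDegree_lt ?_, ?_⟩
    · have h1 := natDegree_lt_of_degree_lt hr hP
      have h2 := natDegree_lt_of_degree_lt (Nat.succ_pos _) hQ
      have h3 : (P * Q).natDegree ≤ _ := natDegree_mul_le
      rw [mul_add]
      omega
    · ext i
      simp only [Pi.mul_apply, eval_mul]
      ring
  · intro v hv
    obtain ⟨P, hP, rfl⟩ := mem_GRSCode_iff.1 hv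
    have hsum : (fun i => y i ^ (t + 1) * P.eval (x i)) =
        ∑ k ∈ Finset.range ((r - 1) * (t + 1) + 1),
          P.coeff k • fun i => y i ^ (t + 1) * x i ^ k := by
      ext i
      conv_lhs => rw [P.as_sum_range' _ (natDegree_lt_of_degree_lt (Nat.succ_pos _) hP)]
      simp [eval_finsetSum, Finset.mul_sum, mul_left_comm]
    rw [hsum]
    refine Submodule.sum_mem _ fun k hk => Submodule.smul_mem _ _ ?_
    have hk := Finset.mem_range.1 hk
    obtain ⟨a, b, ha, hb, rfl⟩ : ∃ a b, a < r ∧ b < r ∧ k = a + b * t := by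
      by_cases hkr : k / t < r
      · exact ⟨k % t, k / t, (Nat.mod_lt _ ht).trans_le htr, hkr,
          by rw [mul_comm]; exact (Nat.mod_add_div k t).symm⟩
      · have h1 : r * t ≤ k := (Nat.le_div_iff_mul_le ht).1 (not_lt.1 hkr)
        have h2 : (r - 1) * t ≤ r * t := Nat.mul_le_mul_right _ (by omega)
        rw [mul_add] at hk
        exact ⟨k - (r - 1) * t, r - 1, by omega, by omega, by omega⟩
    have hmono (j : ℕ) (hj : j < r) : (fun i => y i * x i ^ j) ∈ GRSCode r x y :=
      mem_GRSCode_iff.2 ⟨X ^ j, by rw [degree_X_pow]; exact_mod_cast hj, by simp⟩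
    refine Submodule.subset_span ⟨_, hmono a ha, _,
      Submodule.subset_span ⟨_, hmono b hb, rfl⟩, ?_⟩
    ext i
    simp only [Pi.mul_apply]
    ring

theorem trVecLM_pow_card {Fq Fqm : Type*} [Field Fq] [Field Fqm] [Algebra Fq Fqm]
    [Fintype Fq] [FiniteDimensional Fq Fqm] {n : ℕ} (v : Fin n → Fqm) :
    trVecLM Fq Fqm n (v ^ Fintype.card Fq) = trVecLM Fq Fqm n v :=
  funext fun i => Algebra.trace_eq_of_algEquiv
    (FiniteField.frobeniusAlgEquivOfAlgebraic Fq Fqm) (v i)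

theorem trVecLM_mem_traceCode {Fq Fqm : Type*} [Field Fq] [Field Fqm] [Algebra Fq Fqm] {n N : ℕ}
    {x y : Fin n → Fqm} {P : Fqm[X]} (hP : P.degree < (N : WithBot ℕ)) :
    trVecLM Fq Fqm n (fun i => y i * P.eval (x i)) ∈ traceCode Fq Fqm (GRSCode N x y) :=
  ⟨_, mem_GRSCode_iff.2 ⟨P, hP, rfl⟩, rfl⟩

theorem trVecLM_pow_mul_eval_mem {Fq Fqm : Type*} [Field Fq] [Field Fqm] [Algebra Fq Fqm]
    [Fintype Fq] [FiniteDimensional Fq Fqm] {n r s q : ℕ} (hq : Fintype.card Fq = q)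
    (hr : 1 ≤ r) {Γ : Fqm[X]} (hΓ : Γ.natDegree = r) {x y : Fin n → Fqm}
    (hy : ∀ i, y i * Γ.eval (x i) = 1) (A : Fqm[X]) (hA : A.natDegree < r * s) :
    trVecLM Fq Fqm n (fun i => y i ^ s * A.eval (x i)) ∈
      traceCode Fq Fqm (GRSCode (r * (q * s - s + 1)) x fun i => y i ^ (q * s + 1)) := by
  have hq2 : 2 ≤ q := hq ▸ Fintype.one_lt_card
  have hΓ0 : Γ ≠ 0 := by
    rintro rfl
    simp at hΓ
    omega
  obtain ⟨e, he⟩ : ∃ e, q * s = s + e :=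
    Nat.exists_eq_add_of_le (Nat.le_mul_of_pos_left s (by omega))
  have he' : q * s - s = e := by omega
  rw [he']
  induction hd : A.natDegree using Nat.strong_induction_on generalizing A with
  | _ d ih =>
  have hfrob : trVecLM Fq Fqm n (fun i => y i ^ s * A.eval (x i)) =
      trVecLM Fq Fqm n (fun i => y i ^ (q * s + 1) * (A ^ q * Γ).eval (x i)) := by
    rw [← trVecLM_pow_card, hq]
    congr 1
    ext i
    simp only [Pi.pow_apply, eval_mul, eval_pow]
    linear_combination (-(y i ^ s * A.eval (x i)) ^ q) * hy i
  rw [hfrob]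
  have hG : (Γ ^ (e + 1)).natDegree = r * (e + 1) := by
    rw [natDegree_pow, hΓ, mul_comm]
  by_cases hlt : (A ^ q * Γ).natDegree < r * (e + 1)
  · exact trVecLM_mem_traceCode (degree_lt_of_natDegree_lt hlt)
  · obtain ⟨B, R, hBR, hR, hB⟩ := exists_eq_mul_add (A ^ q * Γ) (Γ ^ (e + 1))
      (pow_ne_zero _ hΓ0) (by rw [hG]; omega)
    rw [hG] at hR hB
    have hdeg : (A ^ q * Γ).natDegree ≤ q * d + r := by
      refine natDegree_mul_le.trans (add_le_add ?_ hΓ.le)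
      exact natDegree_pow_le.trans (by rw [hd])
    have hBd : B.natDegree < d := by
      have h1 : r * e + B.natDegree ≤ q * d := by
        rw [mul_add] at hB
        omega
      obtain ⟨k, rfl⟩ := Nat.exists_eq_add_of_le' (show 1 ≤ q by omega)
      have hek : e = k * s := by
        rw [add_mul] at he
        omega
      have h2 : k * d < k * (r * s) := Nat.mul_lt_mul_of_pos_left (by omega) (by omega)
      rw [hek, mul_left_comm, add_mul] at h1
      omega
    have hsplit : (fun i => y i ^ (q * s + 1) * (A ^ q * Γ).eval (x i)) =
        (fun i => y i ^ s * B.eval (x i)) + fun i => y i ^ (q * s + 1) * R.eval (x i) := by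
      ext i
      have h1 : y i ^ (e + 1) * Γ.eval (x i) ^ (e + 1) = 1 := by rw [← mul_pow, hy, one_pow]
      rw [hBR, he]
      simp only [Pi.add_apply, eval_add, eval_mul, eval_pow]
      linear_combination (y i ^ s * B.eval (x i)) * h1
    rw [hsplit, map_add]
    exact Submodule.add_mem _ (ih _ hBd B (by omega) rfl) (trVecLM_mem_traceCode hR)

theorem traceCode_GRSCode_pow_add_one_le {Fq Fqm : Type*} [Field Fq] [Field Fqm]
    [Algebra Fq Fqm] [Fintype Fq] [FiniteDimensional Fq Fqm] {n r s q N : ℕ}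
    (hq : Fintype.card Fq = q) (hr : 1 ≤ r) {Γ : Fqm[X]} (hΓ : Γ.natDegree = r)
    {x y : Fin n → Fqm} (hy : ∀ i, y i * Γ.eval (x i) = 1) (hN : N ≤ r * (s + 1)) :
    traceCode Fq Fqm (GRSCode N x fun i => y i ^ (s + 1)) ≤
      traceCode Fq Fqm (GRSCode (r * (q * s - s + 1)) x fun i => y i ^ (q * s + 1)) := by
  have hq2 : 2 ≤ q := hq ▸ Fintype.one_lt_card
  have hΓ0 : Γ ≠ 0 := by
    rintro rfl
    simp at hΓ
    omega
  obtain ⟨e, he⟩ : ∃ e, q * s = s + e :=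
    Nat.exists_eq_add_of_le (Nat.le_mul_of_pos_left s (by omega))
  have he' : q * s - s = e := by omega
  rintro _ ⟨v, hv, rfl⟩
  obtain ⟨P, hP, rfl⟩ := mem_GRSCode_iff.1 hv
  have hP' : P.natDegree < r * (s + 1) :=
    natDegree_lt_of_degree_lt (Nat.mul_pos hr (Nat.succ_pos s))
      (hP.trans_le (by exact_mod_cast hN))
  have hlow (R : Fqm[X]) (hR : R.natDegree < r) :
      trVecLM Fq Fqm n (fun i => y i ^ (s + 1) * R.eval (x i)) ∈
        traceCode Fq Fqm (GRSCode (r * (q * s - s + 1)) x fun i => y i ^ (q * s + 1)) := by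
    have hR' : (fun i => y i ^ (s + 1) * R.eval (x i)) =
        fun i => y i ^ (q * s + 1) * (R * Γ ^ e).eval (x i) := by
      ext i
      have h1 : y i ^ e * Γ.eval (x i) ^ e = 1 := by rw [← mul_pow, hy, one_pow]
      rw [he]
      simp only [eval_mul, eval_pow]
      linear_combination (-y i ^ (s + 1) * R.eval (x i)) * h1
    rw [hR']
    refine trVecLM_mem_traceCode (degree_lt_of_natDegree_lt ?_)
    have h1 : (R * Γ ^ e).natDegree ≤ _ := natDegree_mul_le
    rw [natDegree_pow, hΓ, mul_comm e] at h1
    rw [he', mul_add]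
    omega
  by_cases hPr : P.natDegree < r
  · exact hlow P hPr
  · obtain ⟨A, R, hAR, hR, hA⟩ := exists_eq_mul_add P Γ hΓ0 (by omega)
    rw [hΓ] at hR hA
    have hsplit : (fun i => y i ^ (s + 1) * P.eval (x i)) =
        (fun i => y i ^ s * A.eval (x i)) + fun i => y i ^ (s + 1) * R.eval (x i) := by
      ext i
      rw [hAR]
      simp only [Pi.add_apply, eval_add, eval_mul]
      linear_combination (y i ^ s * A.eval (x i)) * hy i
    rw [hsplit, map_add]
    refine Submodule.add_mem _ (trVecLM_pow_mul_eval_mem hq hr hΓ hy A ?_)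
      (hlow R (natDegree_lt_of_degree_lt hr hR))
    rw [mul_add] at hP'
    omega

theorem traceCode_GRSCode_mono {Fq Fqm : Type*} [Field Fq] [Field Fqm] [Algebra Fq Fqm]
    {n N M : ℕ} (h : N ≤ M) (x y : Fin n → Fqm) :
    traceCode Fq Fqm (GRSCode N x y) ≤ traceCode Fq Fqm (GRSCode M x y) := by
  rintro _ ⟨v, hv, rfl⟩
  obtain ⟨P, hP, rfl⟩ := mem_GRSCode_iff.1 hv
  exact trVecLM_mem_traceCode (hP.trans_le (by exact_mod_cast h))

theorem traceCode_GRSCode_pow_mul_add_one {Fq Fqm : Type*} [Field Fq] [Field Fqm]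
    [Algebra Fq Fqm] [Fintype Fq] [FiniteDimensional Fq Fqm] {n r s q : ℕ}
    (hq : Fintype.card Fq = q) (hr : q ≤ r) (hs : 1 ≤ s) {Γ : Fqm[X]} (hΓ : Γ.natDegree = r)
    {x y : Fin n → Fqm} (hy : ∀ i, y i * Γ.eval (x i) = 1) :
    traceCode Fq Fqm (GRSCode ((r - 1) * (q * s + 1) + 1) x fun i => y i ^ (q * s + 1)) =
      traceCode Fq Fqm (GRSCode (r * (q * s - s + 1)) x fun i => y i ^ (q * s + 1)) := by
  have hq2 : 2 ≤ q := hq ▸ Fintype.one_lt_card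
  have hΓ0 : Γ ≠ 0 := by
    rintro rfl
    simp at hΓ
    omega
  obtain ⟨e, he⟩ : ∃ e, q * s = s + e :=
    Nat.exists_eq_add_of_le (Nat.le_mul_of_pos_left s (by omega))
  have he' : q * s - s = e := by omega
  obtain ⟨k, rfl⟩ : ∃ k, r = k + 1 := Nat.exists_eq_add_of_le' (by omega)
  apply le_antisymm
  · rintro _ ⟨v, hv, rfl⟩
    obtain ⟨P, hP, rfl⟩ := mem_GRSCode_iff.1 hv
    have hP' := natDegree_lt_of_degree_lt (Nat.succ_pos _) hP
    by_cases hlt : P.natDegree < (k + 1) * (e + 1)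
    · exact trVecLM_mem_traceCode (degree_lt_of_natDegree_lt (by rwa [he']))
    have hG : (Γ ^ (e + 1)).natDegree = (k + 1) * (e + 1) := by
      rw [natDegree_pow, hΓ, mul_comm]
    obtain ⟨A, R, hAR, hR, hA⟩ := exists_eq_mul_add P (Γ ^ (e + 1)) (pow_ne_zero _ hΓ0)
      (by rw [hG]; omega)
    rw [hG] at hR hA
    have hsplit : (fun i => y i ^ (q * s + 1) * P.eval (x i)) =
        (fun i => y i ^ s * A.eval (x i)) + fun i => y i ^ (q * s + 1) * R.eval (x i) := by
      ext i
      have h1 : y i ^ (e + 1) * Γ.eval (x i) ^ (e + 1) = 1 := by rw [← mul_pow, hy, one_pow]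
      rw [hAR, he]
      simp only [Pi.add_apply, eval_add, eval_mul, eval_pow]
      linear_combination (y i ^ s * A.eval (x i)) * h1
    rw [hsplit, map_add]
    refine Submodule.add_mem _ (trVecLM_pow_mul_eval_mem hq (by omega) hΓ hy A ?_)
      (trVecLM_mem_traceCode (by rwa [he']))
    simp only [he, Nat.add_sub_cancel] at hP'
    nlinarith
  · refine traceCode_GRSCode_mono ?_ x _
    have h1 : q * s ≤ (k + 1) * s := Nat.mul_le_mul_right _ hr
    rw [he', he, Nat.add_sub_cancel]
    rw [he] at h1
    nlinarith

/-- With `Γ` of degree `r ≥ 1`, `y_i = 1/Γ(x_i)`, `C = GRS_r(x,y)`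
and `f = ⌊log_q r⌋`: for every `0 ≤ u ≤ f`, `Tr(C ⋆ C^{q^u}) = B_u`, and these codes
form a chain `Tr(C ⋆ C) ⊆ Tr(C ⋆ C^q) ⊆ … ⊆ Tr(C ⋆ C^{q^f})`. -/
theorem traceCode_schur_frob_eq_BCode_and_chain
    (q m n : ℕ) (hm : 1 < m)
    (Fq Fqm : Type*) [Field Fq] [Field Fqm] [Algebra Fq Fqm]
    [Fintype Fq] [Fintype Fqm]
    (hq : Fintype.card Fq = q) (hqm : Fintype.card Fqm = q ^ m)
    (r : ℕ) (hr : 1 ≤ r) (Γ : Polynomial Fqm) (hΓ : Γ.degree = (r : WithBot ℕ))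
    (x : Fin n → Fqm) (hx : Function.Injective x) (hΓx : ∀ i, Γ.eval (x i) ≠ 0)
    (y : Fin n → Fqm) (hy : ∀ i, y i = (Γ.eval (x i))⁻¹)
    (f : ℕ) (hf : f = Nat.log q r) :
    (∀ u ≤ f,
        traceCode Fq Fqm (schurProd (GRSCode r x y) (powCode (q ^ u) (GRSCode r x y))) =
          BCode Fq Fqm q r x y u) ∧
      (∀ u v : ℕ, u ≤ v → v ≤ f →
        traceCode Fq Fqm (schurProd (GRSCode r x y) (powCode (q ^ u) (GRSCode r x y))) ≤
          traceCode Fq Fqm (schurProd (GRSCode r x y) (powCode (q ^ v) (GRSCode r x y)))) := by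
  have hq2 : 2 ≤ q := hq ▸ Fintype.one_lt_card
  have hΓr : Γ.natDegree = r := natDegree_eq_of_degree_eq_some hΓ
  have hy' (i : Fin n) : y i * Γ.eval (x i) = 1 := by rw [hy, inv_mul_cancel₀ (hΓx i)]
  have hqr {u : ℕ} (hu : u ≤ f) : q ^ u ≤ r := Nat.pow_le_of_le_log (by omega) (hf ▸ hu)
  have hpos (u : ℕ) : 1 ≤ q ^ u := Nat.one_le_pow _ _ (by omega)
  have hschur {u : ℕ} (hu : u ≤ f) := schurProd_powCode_GRSCode hr (hpos u) (hqr hu) x y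
  have hsucc {u : ℕ} (hu : u + 1 ≤ f) := traceCode_GRSCode_pow_mul_add_one (s := q ^ u) hq
    ((Nat.le_self_pow (Nat.succ_ne_zero u) q).trans (hqr hu)) (hpos u) hΓr hy'
  refine ⟨fun u hu => ?_, fun u v huv hv => ?_⟩
  · rw [hschur hu]
    cases u with
    | zero =>
      rw [BCode, dualCode_AltCode, show (r - 1) * (q ^ 0 + 1) + 1 = 2 * r - 1 by
        rw [pow_zero]; omega, pow_zero]
    | succ u =>
      rw [BCode, dualCode_AltCode, pow_succ', hsucc hu]
  · induction v, huv using Nat.le_induction with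
    | base => exact le_rfl
    | succ v huv ih =>
      refine (ih (by omega)).trans ?_
      rw [hschur hv, hschur (show v ≤ f by omega), pow_succ', hsucc hv]
      refine traceCode_GRSCode_pow_add_one_le hq hr hΓr hy' ?_
      obtain ⟨k, rfl⟩ := Nat.exists_eq_add_of_le' hr
      rw [Nat.add_sub_cancel, add_mul]
      omega
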